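/- Let ε : ℕ → ℝ be a sequence with ε(n) > 0 for all n ≥ 1, monotonically decreasing, and tending to 0, and suppose Σ_{n=1}^∞ ε(n)/n = ∞. Then the series Σ_{n=1}^∞ (ε(n)/n)·sin(nt) converges uniformly on ℝ to a continuous 2π-periodic function g, whose Fourier coefficients satisfy ĝ(k) = O(ε(|k|)/|k|), and there exists no essentially bounded function w ∈ L^∞(𝕋) with ŵ(k) = -i·sgn(k)·ĝ(k) for all k ∈ ℤ; that is, the conjugate function g̃ does not belong to L^∞(𝕋). -/

import Mathlib

open scoped Real

theorem abel_bound (b z : ℕ → ℝ) (p : ℕ) (C : ℝ) (hb : ∀ n, p ≤ n → 0 ≤ b n)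
    (hb' : ∀ n, p ≤ n → b (n+1) ≤ b n)
    (hz : ∀ q, p ≤ q → |∑ n ∈ Finset.Ico p q, z n| ≤ C) (q : ℕ) (hq : p ≤ q) :
    |∑ n ∈ Finset.Ico p q, b n * z n| ≤ C * b p := by
  have key : |∑ n ∈ Finset.Ico p q, b n * z n - b q * ∑ n ∈ Finset.Ico p q, z n|
      ≤ C * (b p - b q) := by
    induction q, hq using Nat.le_induction with
    | base => simp
    | succ q hq ih =>
      have h1 := hz (q+1) (by omega)
      have e : ∑ n ∈ Finset.Ico p (q+1), b n * z n - b (q+1) * ∑ n ∈ Finset.Ico p (q+1), z n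
        = (∑ n ∈ Finset.Ico p q, b n * z n - b q * ∑ n ∈ Finset.Ico p q, z n)
          + (b q - b (q+1)) * ∑ n ∈ Finset.Ico p (q+1), z n := by
        rw [Finset.sum_Ico_succ_top hq, Finset.sum_Ico_succ_top hq]; ring
      rw [e]
      refine (abs_add_le _ _).trans ?_
      rw [abs_mul, abs_of_nonneg (sub_nonneg.2 (hb' q hq))]
      have := mul_le_mul_of_nonneg_left h1 (sub_nonneg.2 (hb' q hq))
      linarith
  have h2 : |b q * ∑ n ∈ Finset.Ico p q, z n| ≤ b q * C := by
    rw [abs_mul, abs_of_nonneg (hb q hq)]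
    exact mul_le_mul_of_nonneg_left (hz q hq) (hb q hq)
  have := abs_add_le (∑ n ∈ Finset.Ico p q, b n * z n - b q * ∑ n ∈ Finset.Ico p q, z n) (b q * ∑ n ∈ Finset.Ico p q, z n)
  rw [sub_add_cancel] at this
  linarith

theorem sin_sum_id (t : ℝ) (p q : ℕ) (h : p ≤ q) :
    2 * Real.sin (t/2) * ∑ n ∈ Finset.Ico p q, Real.sin (n*t)
      = Real.cos (p*t - t/2) - Real.cos (q*t - t/2) := by
  induction q, h using Nat.le_induction with
  | base => simp
  | succ q hq ih =>
    rw [Finset.sum_Ico_succ_top hq, mul_add, ih]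
    have : ((q+1 : ℕ) : ℝ) * t - t/2 = q * t + t/2 := by push_cast; ring
    rw [this, Real.cos_add, Real.cos_sub ((q:ℝ)*t)]; ring

theorem abs_sin_nat (n : ℕ) (t : ℝ) : |Real.sin (n*t)| ≤ 2 * n * |Real.sin (t/2)| := by
  have h0 : |Real.sin t| ≤ 2 * |Real.sin (t/2)| := by
    have : Real.sin t = 2 * Real.sin (t/2) * Real.cos (t/2) := by
      rw [← Real.sin_two_mul]; congr 1; ring
    rw [this, abs_mul, abs_mul, abs_two]
    exact mul_le_of_le_one_right (by positivity) (Real.abs_cos_le_one _)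
  induction n with
  | zero => simp
  | succ n ih =>
    have : ((n+1 : ℕ) : ℝ) * t = n * t + t := by push_cast; ring
    rw [this, Real.sin_add]
    refine (abs_add_le _ _).trans ?_
    rw [abs_mul, abs_mul]
    have h1 := mul_le_of_le_one_right (abs_nonneg (Real.sin (n*t))) (Real.abs_cos_le_one t)
    have h2 := mul_le_of_le_one_left (abs_nonneg (Real.sin t)) (Real.abs_cos_le_one (n*t))
    push_cast; linarith

theorem tail_bound (ε : ℕ → ℝ)
    (hpos : ∀ n : ℕ, 1 ≤ n → 0 < ε n)
    (hdec : ∀ m n : ℕ, 1 ≤ m → m ≤ n → ε n ≤ ε m) (t : ℝ) (p q : ℕ) (hp : 1 ≤ p) (hq : p ≤ q) :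
    |∑ n ∈ Finset.Ico p q, ε n / n * Real.sin (n * t)| ≤ 3 * ε p := by
  set s := |Real.sin (t/2)| with hs
  have hεp := hpos p hp
  have term : ∀ n, p ≤ n → |ε n / n * Real.sin (n*t)| ≤ ε p * (2 * s) := by
    intro n hn
    have hn0 : (0:ℝ) < n := by exact_mod_cast (by omega : 0 < n)
    have h1 := abs_sin_nat n t
    have h2 := hpos n (by omega)
    have h3 := hdec p n hp hn
    rw [abs_mul, abs_of_nonneg (by positivity)]
    calc ε n / n * |Real.sin (n*t)| ≤ ε n / n * (2 * n * s) := by gcongr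
      _ = ε n * (2 * s) := by field_simp
      _ ≤ _ := by gcongr
  have hs0 : 0 ≤ s := abs_nonneg _
  rcases hs0.eq_or_lt with h0 | h0
  · have : ∑ n ∈ Finset.Ico p q, ε n / n * Real.sin (n * t) = 0 := by
      apply Finset.sum_eq_zero
      intro n hn
      have := term n (Finset.mem_Ico.1 hn).1
      rw [← h0] at this
      exact abs_nonpos_iff.1 (by simpa only [mul_zero] using this)
    rw [this]; simp; exact hεp.le
  set K := ⌊1/s⌋₊ with hK
  have hK1 : (K:ℝ) ≤ 1/s := Nat.floor_le (by positivity)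
  have hK2 : 1/s < K + 1 := Nat.lt_floor_add_one _
  have first : ∀ r, p ≤ r → r ≤ K + 1 →
      |∑ n ∈ Finset.Ico p r, ε n / n * Real.sin (n * t)| ≤ 2 * ε p := by
    intro r hr hrK
    refine (Finset.abs_sum_le_sum_abs _ _).trans ?_
    refine (Finset.sum_le_card_nsmul _ _ _ (fun n hn => term n (Finset.mem_Ico.1 hn).1)).trans ?_
    rw [Nat.card_Ico, nsmul_eq_mul]
    have : ((r - p : ℕ) : ℝ) ≤ K := by exact_mod_cast (by omega : r - p ≤ K)
    have h5 : (K:ℝ) * s ≤ 1 := by rwa [le_div_iff₀ h0] at hK1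
    calc ((r - p : ℕ) : ℝ) * (ε p * (2 * s)) ≤ K * (ε p * (2 * s)) := by gcongr
      _ = 2 * ε p * (K * s) := by ring
      _ ≤ 2 * ε p * 1 := by gcongr
      _ = _ := by ring
  have second : ∀ m, p ≤ m → K + 1 ≤ m → m ≤ q →
      |∑ n ∈ Finset.Ico m q, ε n / n * Real.sin (n * t)| ≤ ε p := by
    intro m hm hmK hmq
    have hm0 : (0:ℝ) < m := by exact_mod_cast (by omega : 0 < m)
    refine (abel_bound (fun n => ε n / n) (fun n => Real.sin (n*t)) m (1/s) ?_ ?_ ?_ q hmq).trans ?_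
    · intro n hn
      have := hpos n (by omega)
      positivity
    · intro n hn
      have h1 := hpos n (by omega)
      have h2 := hdec n (n+1) (by omega) (by omega)
      have hn0 : (0:ℝ) < n := by exact_mod_cast (by omega : 0 < n)
      push_cast
      gcongr
      linarith
    · intro r hr
      have := sin_sum_id t m r hr
      have h6 := congrArg abs this
      rw [abs_mul, abs_mul, abs_two, ← hs] at h6
      have h7 := abs_sub (Real.cos (m*t - t/2)) (Real.cos (r*t - t/2))
      have h8 := Real.abs_cos_le_one (m*t - t/2)
      have h9 := Real.abs_cos_le_one (r*t - t/2)
      rw [le_div_iff₀ h0]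
      nlinarith
    · have h3 := hdec p m hp hm
      have h4 : (K:ℝ) + 1 ≤ m := by exact_mod_cast hmK
      have h5 : 1 / s ≤ m := by linarith
      have h6 := hpos m (by omega)
      calc 1 / s * (ε m / m) ≤ m * (ε m / m) := by gcongr
        _ = ε m := by field_simp
        _ ≤ _ := h3
  by_cases c1 : q ≤ K + 1
  · have := first q hq c1; linarith
  by_cases c2 : K + 1 ≤ p
  · have := second p le_rfl c2 hq; linarith
  have a1 := first (K+1) (by omega) le_rfl
  have a2 := second (K+1) (by omega) le_rfl (by omega)
  rw [← Finset.sum_Ico_consecutive _ (by omega : p ≤ K+1) (by omega : K+1 ≤ q)]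
  refine (abs_add_le _ _).trans ?_
  linarith

theorem exists_g (ε : ℕ → ℝ)
    (hpos : ∀ n : ℕ, 1 ≤ n → 0 < ε n)
    (hdec : ∀ m n : ℕ, 1 ≤ m → m ≤ n → ε n ≤ ε m)
    (hlim : Filter.Tendsto ε Filter.atTop (nhds 0)) :
    ∃ g : ℝ → ℝ, ∀ (N : ℕ) (t : ℝ),
      |g t - ∑ n ∈ Finset.Icc 1 N, ε n / n * Real.sin (n * t)| ≤ 3 * ε (N+1) := by
  have hl : Filter.Tendsto (fun N => 3 * ε (N+1)) Filter.atTop (nhds 0) := by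
    simpa using ((Filter.tendsto_add_atTop_iff_nat 1).2 hlim).const_mul 3
  have hb : ∀ (t : ℝ) (N M : ℕ), N ≤ M →
      |∑ n ∈ Finset.Icc 1 M, ε n / n * Real.sin (n * t) - ∑ n ∈ Finset.Icc 1 N, ε n / n * Real.sin (n * t)|
        ≤ 3 * ε (N+1) := by
    intro t N M h
    have := tail_bound ε hpos hdec t (N+1) (M+1) (by omega) (by omega)
    have e : ∀ N : ℕ, Finset.Icc 1 N = Finset.Ico 1 (N+1) := fun N => by ext; simp
    rw [e, e, ← Finset.sum_Ico_consecutive _ (by omega : 1 ≤ N+1) (by omega : N+1 ≤ M+1)]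
    simpa using this
  have hc : ∀ t : ℝ, ∃ l, Filter.Tendsto (fun M => ∑ n ∈ Finset.Icc 1 M, ε n / n * Real.sin (n * t)) Filter.atTop (nhds l) := by
    intro t
    apply cauchySeq_tendsto_of_complete
    apply cauchySeq_of_le_tendsto_0' (fun N => 3 * ε (N+1)) _ hl
    intro N M h
    rw [dist_comm, Real.dist_eq]
    exact hb t N M h
  choose g hg using hc
  refine ⟨g, fun N t => ?_⟩
  refine le_of_tendsto ((hg t).sub_const _).abs ?_
  filter_upwards [Filter.eventually_ge_atTop N] with M hM using hb t N M hM


theorem coeff_integral (w : AddCircle (2*π) → ℂ) [Fact ((0 : ℝ) < 2 * π)]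
    (hw : MeasureTheory.Integrable w AddCircle.haarAddCircle) (N : ℕ) :
    ∫ x, ((‖∑ j ∈ Finset.range N, fourier (j:ℤ) x‖^2 : ℝ) : ℂ) * w x ∂AddCircle.haarAddCircle
      = ∑ j ∈ Finset.range N, ∑ l ∈ Finset.range N, fourierCoeff w ((l:ℤ) - j) := by
  have e : ∀ x : AddCircle (2*π), ((‖∑ j ∈ Finset.range N, fourier (j:ℤ) x‖^2 : ℝ) : ℂ) * w x
      = ∑ j ∈ Finset.range N, ∑ l ∈ Finset.range N, fourier (-((l:ℤ) - j)) x • w x := by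
    intro x
    push_cast
    rw [← Complex.mul_conj', map_sum, Finset.sum_mul_sum, Finset.sum_mul]
    refine Finset.sum_congr rfl fun j _ => ?_
    rw [Finset.sum_mul]
    refine Finset.sum_congr rfl fun l _ => ?_
    rw [← fourier_neg, ← fourier_add, smul_eq_mul]
    congr 3
    ring
  simp_rw [e]
  have hi : ∀ n : ℤ, MeasureTheory.Integrable (fun x => fourier n x • w x) AddCircle.haarAddCircle :=
    fun n => hw.fourier_smul n
  rw [MeasureTheory.integral_finsetSum _ (fun j _ => MeasureTheory.integrable_finsetSum _ (fun l _ => hi _))]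
  refine Finset.sum_congr rfl fun j _ => ?_
  rw [MeasureTheory.integral_finsetSum _ (fun l _ => hi _)]
  rfl

theorem fejer_bound (w : AddCircle (2*π) → ℂ) [Fact ((0 : ℝ) < 2 * π)]
    (hw : MeasureTheory.Integrable w AddCircle.haarAddCircle) (M : ℝ)
    (hM : ∀ᵐ x ∂AddCircle.haarAddCircle, ‖w x‖ ≤ M) (N : ℕ) :
    ‖∑ j ∈ Finset.range N, ∑ l ∈ Finset.range N, fourierCoeff w ((l:ℤ) - j)‖ ≤ M * N := by
  rw [← coeff_integral w hw N]
  have h1 := coeff_integral (fun _ => (1:ℂ)) (MeasureTheory.integrable_const _) N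
  have hc : ∀ n : ℤ, fourierCoeff (fun _ : AddCircle (2*π) => (1:ℂ)) n = if n = 0 then 1 else 0 := by
    intro n
    have : (fun _ : AddCircle (2*π) => (1:ℂ)) = ⇑(fourier 0 : C(AddCircle (2*π), ℂ)) := by
      ext; simp
    rw [this, fourierCoeff_fourier]
    simp [Pi.single_apply]
  have h2 : ∑ j ∈ Finset.range N, ∑ l ∈ Finset.range N,
      fourierCoeff (fun _ : AddCircle (2*π) => (1:ℂ)) ((l:ℤ) - j) = N := by
    simp_rw [hc, sub_eq_zero, Nat.cast_inj, Finset.sum_ite_eq']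
    rw [Finset.sum_congr rfl (fun j hj => if_pos hj)]
    simp
  rw [h2] at h1
  simp only [mul_one] at h1
  rw [integral_complex_ofReal] at h1
  have h3 : ∫ x : AddCircle (2*π), ‖∑ j ∈ Finset.range N, fourier (j:ℤ) x‖^2 ∂AddCircle.haarAddCircle = N := by
    exact_mod_cast h1
  rw [← h3, ← MeasureTheory.integral_const_mul]
  refine MeasureTheory.norm_integral_le_of_norm_le ?_ ?_
  · refine Continuous.integrable_of_hasCompactSupport (by fun_prop) ?_
    exact HasCompactSupport.of_compactSpace _
  · filter_upwards [hM] with x hx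
    rw [norm_mul, Complex.norm_real, Real.norm_of_nonneg (by positivity), mul_comm]
    gcongr

theorem summable_of_bdd (ε : ℕ → ℝ)
    (hpos : ∀ n : ℕ, 1 ≤ n → 0 < ε n) (M : ℝ)
    (c : ℤ → ℝ) (hc : ∀ n, 0 ≤ c n) (hc' : ∀ n : ℕ, 1 ≤ n → c n = ε n / (2 * n))
    (h : ∀ N : ℕ, ∑ j ∈ Finset.range N, ∑ l ∈ Finset.range N, c ((l:ℤ) - j) ≤ M * N) :
    Summable (fun n : ℕ => ε n / n) := by
  have hnn : ∀ n : ℕ, 0 ≤ ε n / n := by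
    intro n
    rcases Nat.eq_zero_or_pos n with rfl | h
    · simp
    · have := hpos n h; positivity
  apply summable_of_sum_range_le (c := 4 * M) hnn
  intro N
  rcases Nat.eq_zero_or_pos N with rfl | hN
  · have := h 1
    simp at this
    have h2 := hc 0
    simp; linarith
  have h1 := h (2 * N)
  have h2 : ∑ j ∈ Finset.range N, ∑ n ∈ Finset.range N, ε n / (2 * n) ≤
      ∑ j ∈ Finset.range (2*N), ∑ l ∈ Finset.range (2*N), c ((l:ℤ) - j) := by
    refine (Finset.sum_le_sum ?_).trans (Finset.sum_le_sum_of_subset_of_nonneg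
      (Finset.range_mono (by omega : N ≤ 2 * N)) (fun j _ _ => Finset.sum_nonneg fun l _ => hc _))
    intro j hj
    rw [Finset.mem_range] at hj
    calc ∑ n ∈ Finset.range N, ε n / (2 * n) ≤ ∑ n ∈ Finset.range N, c (((j + n : ℕ):ℤ) - j) := by
          refine Finset.sum_le_sum fun n _ => ?_
          rcases Nat.eq_zero_or_pos n with rfl | h
          · simpa using hc 0
          · rw [← hc' n h]; simp
      _ = ∑ l ∈ Finset.Ico j (j + N), c ((l:ℤ) - j) := by
          rw [Finset.sum_Ico_eq_sum_range]; simp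
      _ ≤ _ := by
          refine Finset.sum_le_sum_of_subset_of_nonneg ?_ (fun _ _ _ => hc _)
          intro l hl
          simp at hl ⊢; omega
  rw [Finset.sum_const, Finset.card_range, nsmul_eq_mul] at h2
  have h3 : ∑ n ∈ Finset.range N, ε n / (2 * n) = (∑ n ∈ Finset.range N, ε n / n) / 2 := by
    rw [Finset.sum_div]; refine Finset.sum_congr rfl fun n _ => ?_
    rw [div_div, mul_comm]
  rw [h3] at h2
  have h4 := h2.trans h1
  push_cast at h4
  have hN' : (0:ℝ) < N := by exact_mod_cast hN
  have : (N:ℝ) * ((∑ n ∈ Finset.range N, ε n / n)) ≤ N * (4 * M) := by linarith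
  exact le_of_mul_le_mul_left this hN'

theorem sin_coeff [Fact ((0 : ℝ) < 2 * π)] (a : ℕ → ℝ) (N : ℕ) (k : ℤ) (hk : k.natAbs ≤ N) (hk0 : k ≠ 0):
    fourierCoeff (fun x : AddCircle (2*π) => ∑ n ∈ Finset.Icc 1 N, ((a n : ℂ) / (2 * Complex.I)) •
      (fourier (n:ℤ) x - fourier (-(n:ℤ)) x)) k = -Complex.I * k.sign * a k.natAbs / 2 := by
  have hI : ∀ m : ℤ, MeasureTheory.Integrable (fun x : AddCircle (2*π) => fourier m x)
      AddCircle.haarAddCircle := fun m =>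
    Continuous.integrable_of_hasCompactSupport (by fun_prop) (HasCompactSupport.of_compactSpace _)
  have h1 : (fun x : AddCircle (2*π) => ∑ n ∈ Finset.Icc 1 N, ((a n : ℂ) / (2 * Complex.I)) •
      (fourier (n:ℤ) x - fourier (-(n:ℤ)) x)) = ∑ n ∈ Finset.Icc 1 N, ((a n : ℂ) / (2 * Complex.I)) •
        ((fun x : AddCircle (2*π) => fourier (n:ℤ) x) + (-1:ℂ) • (fun x : AddCircle (2*π) => fourier (-(n:ℤ)) x)) := by
    ext x; simp [Finset.sum_apply, sub_eq_add_neg, mul_add]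
  rw [h1, fourierCoeff.sum _ _ (fun n _ => (((hI _).add ((hI _).smul _)).smul _))]
  have h2 : ∀ n : ℕ, fourierCoeff (((a n : ℂ) / (2 * Complex.I)) •
        ((fun x : AddCircle (2*π) => fourier (n:ℤ) x) + (-1:ℂ) • (fun x : AddCircle (2*π) => fourier (-(n:ℤ)) x))) k
        = ((a n : ℂ) / (2 * Complex.I)) * ((if k = n then 1 else 0) - if k = -n then 1 else 0) := by
    intro n
    rw [fourierCoeff.const_smul, fourierCoeff.add (hI _) ((hI _).smul _), Pi.add_apply, fourierCoeff.const_smul,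
      fourierCoeff_fourier, fourierCoeff_fourier]
    simp [Pi.single_apply, sub_eq_add_neg]
    left; split_ifs <;> simp
  simp only [Finset.sum_apply, h2]
  rw [Finset.sum_eq_single k.natAbs]
  · rcases lt_or_gt_of_ne hk0 with h | h
    · rw [if_neg (by omega), if_pos (by omega), Int.sign_eq_neg_one_of_neg h]
      field_simp
      simp
    · rw [if_pos (by omega), if_neg (by omega), Int.sign_eq_one_of_pos h]
      field_simp
      simp
  · intro n _ hn
    rw [if_neg (by omega), if_neg (by omega)]; simp
  · intro h; simp at h; omega

theorem coeff_g [Fact ((0 : ℝ) < 2 * π)] (ε : ℕ → ℝ)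
    (hlim : Filter.Tendsto ε Filter.atTop (nhds 0)) (g : ℝ → ℝ) (hgc : Continuous g)
    (hgp : Function.Periodic g (2*π))
    (hg : ∀ (N : ℕ) (t : ℝ),
      |g t - ∑ n ∈ Finset.Icc 1 N, ε n / n * Real.sin (n * t)| ≤ 3 * ε (N+1)) (k : ℤ) (hk : k ≠ 0) :
    fourierCoeff (AddCircle.liftIco (2 * π) 0 (fun t : ℝ => (g t : ℂ))) k
      = -Complex.I * k.sign * (ε k.natAbs / k.natAbs : ℝ) / 2 := by
  set G := AddCircle.liftIco (2 * π) 0 (fun t : ℝ => (g t : ℂ)) with hG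
  have hGc : Continuous G := AddCircle.liftIco_zero_continuous (by simpa using (hgp 0).symm)
    (by fun_prop)
  have hi : ∀ f : AddCircle (2*π) → ℂ, Continuous f → MeasureTheory.Integrable f
      AddCircle.haarAddCircle := fun f hf =>
    Continuous.integrable_of_hasCompactSupport hf (HasCompactSupport.of_compactSpace _)
  have hl : Filter.Tendsto (fun N => 3 * ε (N+1)) Filter.atTop (nhds 0) := by
    simpa using ((Filter.tendsto_add_atTop_iff_nat 1).2 hlim).const_mul 3
  rw [← sub_eq_zero, ← norm_le_zero_iff]
  refine ge_of_tendsto hl ?_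
  filter_upwards [Filter.eventually_ge_atTop k.natAbs] with N hN
  rw [← sin_coeff (fun n => ε n / n) N k hN hk]
  unfold fourierCoeff
  rw [← MeasureTheory.integral_sub]
  · refine (MeasureTheory.norm_integral_le_of_norm_le_const (C := 3 * ε (N+1)) ?_).trans ?_
    · refine Filter.Eventually.of_forall fun x => ?_
      rw [← smul_sub, norm_smul]
      have : ‖(fourier (-k) x : ℂ)‖ = 1 := by rw [fourier_apply, Circle.norm_coe]
      rw [this, one_mul]
      obtain ⟨t, ht, rfl⟩ : ∃ t ∈ Set.Ico (0:ℝ) (2*π), (t : AddCircle (2*π)) = x := by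
        have := AddCircle.coe_image_Ico_eq (2*π) 0
        rw [zero_add] at this
        have h := Set.mem_univ x
        rwa [← this] at h
      rw [hG, AddCircle.liftIco_zero_coe_apply ht]
      refine le_trans (le_of_eq ?_) (hg N t)
      rw [← Real.norm_eq_abs, ← Complex.norm_real]
      congr 1
      push_cast
      congr 1
      refine Finset.sum_congr rfl fun n _ => ?_
      rw [fourier_coe_apply, fourier_coe_apply, Complex.sin, smul_eq_mul]
      have e1 : 2 * (π:ℂ) * Complex.I * ((n:ℤ):ℂ) * t / ((2 * π : ℝ):ℂ) = n * t * Complex.I := by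
        have : (π:ℂ) ≠ 0 := by exact_mod_cast Real.pi_ne_zero
        push_cast; field_simp
      have e2 : 2 * (π:ℂ) * Complex.I * ((-(n:ℤ):ℤ):ℂ) * t / ((2 * π : ℝ):ℂ) = -(n * t) * Complex.I := by
        have : (π:ℂ) ≠ 0 := by exact_mod_cast Real.pi_ne_zero
        push_cast; field_simp
      rw [e1, e2]
      have hI : (Complex.I)⁻¹ = -Complex.I := Complex.inv_I
      rw [div_mul_eq_mul_div, div_eq_mul_inv _ (2 * Complex.I), mul_inv, hI]
      ring
    · simp
  · exact hi _ (by fun_prop)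
  · exact hi _ (by fun_prop)

/-- If `ε(n) > 0` decreases monotonically to `0` and `∑ ε(n)/n = ∞`, then the series
`∑ (ε(n)/n) sin(nt)` converges uniformly to a continuous `2π`-periodic function `g` with
`ĝ(k) = O(ε(|k|)/|k|)`, whose conjugate function does not belong to `L^∞(𝕋)`. -/
theorem sine_series_with_unbounded_conjugate
    [inst : Fact ((0 : ℝ) < 2 * π)]
    (ε : ℕ → ℝ)
    (hpos : ∀ n : ℕ, 1 ≤ n → 0 < ε n)
    (hdec : ∀ m n : ℕ, 1 ≤ m → m ≤ n → ε n ≤ ε m)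
    (hlim : Filter.Tendsto ε Filter.atTop (nhds 0))
    (hdiv : ¬ Summable (fun n : ℕ => ε n / n)) :
    ∃ g : ℝ → ℝ,
      TendstoUniformly
        (fun (N : ℕ) (t : ℝ) => ∑ n ∈ Finset.Icc 1 N, ε n / n * Real.sin (n * t))
        g Filter.atTop ∧
      Continuous g ∧
      Function.Periodic g (2 * π) ∧
      (∃ C : ℝ, 0 < C ∧ ∀ k : ℤ, k ≠ 0 →
        ‖fourierCoeff (AddCircle.liftIco (2 * π) 0 (fun t : ℝ => (g t : ℂ))) k‖ ≤
          C * ε k.natAbs / |(k : ℝ)|) ∧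
      ¬ ∃ w : AddCircle (2 * π) → ℂ,
          MeasureTheory.MemLp w ⊤ MeasureTheory.volume ∧
          ∀ k : ℤ,
            fourierCoeff w k =
              -Complex.I * (k.sign : ℂ) *
                fourierCoeff (AddCircle.liftIco (2 * π) 0 (fun t : ℝ => (g t : ℂ))) k := by
  obtain ⟨g, hg⟩ := exists_g ε hpos hdec hlim
  have hl : Filter.Tendsto (fun N => 3 * ε (N+1)) Filter.atTop (nhds 0) := by
    simpa using ((Filter.tendsto_add_atTop_iff_nat 1).2 hlim).const_mul 3
  have hU : TendstoUniformly
        (fun (N : ℕ) (t : ℝ) => ∑ n ∈ Finset.Icc 1 N, ε n / n * Real.sin (n * t))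
        g Filter.atTop := by
    rw [Metric.tendstoUniformly_iff]
    intro δ hδ
    filter_upwards [hl.eventually_lt_const hδ] with N hN t
    rw [Real.dist_eq]
    exact (hg N t).trans_lt hN
  have hc : Continuous g := hU.continuous (Filter.Frequently.of_forall fun N => by fun_prop)
  have hp : Function.Periodic g (2*π) := by
    intro t
    refine tendsto_nhds_unique (hU.tendsto_at (t + 2*π)) ?_
    convert hU.tendsto_at t using 4 with N n
    rw [mul_add, Real.sin_add_nat_mul_two_pi]
  have hcoeff := coeff_g ε hlim g hc hp hg
  refine ⟨g, hU, hc, hp, ⟨1, one_pos, ?_⟩, ?_⟩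
  · intro k hk
    have h1 := hpos k.natAbs (by omega)
    have h2 : |(k:ℝ)| = k.natAbs := by rw [Nat.cast_natAbs]; simp
    have h3 : ‖(k.sign : ℂ)‖ = 1 := by
      rcases lt_or_gt_of_ne hk with h | h
      · rw [Int.sign_eq_neg_one_of_neg h]; simp
      · rw [Int.sign_eq_one_of_pos h]; simp
    have h4 : 0 ≤ ε k.natAbs / k.natAbs := by positivity
    rw [hcoeff k hk, h2, norm_div, norm_mul, norm_mul, h3, Complex.norm_real,
      Real.norm_of_nonneg h4]
    simp only [norm_neg, Complex.norm_I, Complex.norm_two]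
    rw [one_mul, one_mul, one_mul]
    linarith
  · rintro ⟨w, hw, hwc⟩
    have hw' : MeasureTheory.MemLp w ⊤ AddCircle.haarAddCircle :=
      MeasureTheory.memLp_haarAddCircle_iff.2 hw
    have hint : MeasureTheory.Integrable w AddCircle.haarAddCircle := hw'.integrable le_top
    apply hdiv
    have hfej := fejer_bound w hint _ (MeasureTheory.ae_le_lpNorm_exponent_top hw')
    set c : ℤ → ℝ := fun k => if k = 0 then 0 else ε k.natAbs / k.natAbs / 2 with hcdef
    have hcw : ∀ k, fourierCoeff w k = ((-c k : ℝ) : ℂ) := by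
      intro k
      rw [hwc k]
      by_cases hk : k = 0
      · simp [hk, c]
      · rw [hcoeff k hk]
        have h3 : (k.sign : ℂ) * k.sign = 1 := by
          rcases lt_or_gt_of_ne hk with h | h
          · rw [Int.sign_eq_neg_one_of_neg h]; simp
          · rw [Int.sign_eq_one_of_pos h]; simp
        simp only [c, if_neg hk]
        push_cast
        linear_combination (Complex.I * Complex.I * (ε k.natAbs / k.natAbs) / 2 : ℂ) * h3 +
          ((ε k.natAbs / k.natAbs) / 2 : ℂ) * Complex.I_mul_I
    have hcnn : ∀ k, 0 ≤ c k := by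
      intro k
      by_cases hk : k = 0
      · simp [hk, c]
      · simp only [c, if_neg hk]
        have := hpos k.natAbs (by omega)
        positivity
    refine summable_of_bdd ε hpos (MeasureTheory.lpNorm w ⊤ AddCircle.haarAddCircle) c hcnn ?_ (fun N => ?_)
    · intro n hn
      simp only [c]
      rw [if_neg (by omega), Int.natAbs_natCast, div_div, mul_comm]
    · have h := hfej N
      simp_rw [hcw] at h
      rw [← norm_neg] at h
      simp_rw [← Complex.ofReal_sum, ← Complex.ofReal_neg, Complex.norm_real] at h
      simp only [Finset.sum_neg_distrib, neg_neg] at h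
      exact (le_abs_self _).trans h
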